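/- Let 0 < p = q < ∞ and 0 < u ≤ v ≤ ∞. Then there exist constants c, C > 0 depending only on p, u, v such that for all n ∈ ℕ and all k ∈ ℕ: c · 2^{−k/n} ≤ e_k(id: ℓ_{p,u}^n → ℓ_{p,v}^n) ≤ C · 2^{−k/n}. -/

import Mathlib

open scoped ENNReal Classical
open MeasureTheory

/-- The non-increasing rearrangement of `x : ℝ^n`: for `1 ≤ i ≤ n`,
`rearr n x i` is the `i`-th largest of the absolute values of the entries of `x`,
defined via `x_i^* = inf {t ≥ 0 : #{j : |x j| > t} ≤ i - 1}`. -/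
noncomputable def rearr (n : ℕ) (x : Fin n → ℝ) (i : ℕ) : ℝ :=
  sInf {t : ℝ | 0 ≤ t ∧ ((Finset.univ : Finset (Fin n)).filter (fun j => t < |x j|)).card ≤ i - 1}

/-- The Lorentz quasi-norm `‖x‖_{p,u}` on `ℝ^n` for `p, u ∈ (0,∞]`, with the
convention `1/∞ = 0`:  `‖x‖_{p,u} = (∑_{i=1}^n i^{u/p-1} (x_i^*)^u)^{1/u}` for `u < ∞`
and `‖x‖_{p,∞} = max_{1 ≤ i ≤ n} i^{1/p} x_i^*`. -/
noncomputable def lorentzNorm (n : ℕ) (p u : ℝ≥0∞) (x : Fin n → ℝ) : ℝ :=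
  if u = ⊤ then
    sSup {t : ℝ | ∃ i ∈ Finset.Icc 1 n, t = (i : ℝ) ^ (1 / p).toReal * rearr n x i}
  else
    (∑ i ∈ Finset.Icc 1 n, (i : ℝ) ^ ((u / p).toReal - 1) * rearr n x i ^ u.toReal) ^ (1 / u.toReal)

/-- The `k`-th (dyadic) entropy number of the identity map from `(ℝ^n, NX)` to `(ℝ^n, NY)`:
`e_k = inf {ε > 0 : ∃ y_1, …, y_{2^{k-1}} with B_X ⊆ ⋃ (y_i + ε B_Y)}`. -/
noncomputable def entropyNumber (n : ℕ) (NX NY : (Fin n → ℝ) → ℝ) (k : ℕ) : ℝ :=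
  sInf {ε : ℝ | 0 < ε ∧ ∃ T : Finset (Fin n → ℝ), T.card ≤ 2 ^ (k - 1) ∧
    ∀ x : Fin n → ℝ, NX x ≤ 1 → ∃ y ∈ T, NY (x - y) ≤ ε}

/-- The operator norm of the identity map from `(ℝ^n, NX)` to `(ℝ^n, NY)`:
`‖id‖ = sup {NY x : NX x ≤ 1}`. -/
noncomputable def opNorm (n : ℕ) (NX NY : (Fin n → ℝ) → ℝ) : ℝ :=
  sSup {t : ℝ | ∃ x : Fin n → ℝ, NX x ≤ 1 ∧ t = NY x}

theorem rearr_nonneg (n : ℕ) (x : Fin n → ℝ) (i : ℕ) : 0 ≤ rearr n x i :=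
  Real.sInf_nonneg fun _ ht => ht.1

theorem rearr_le_of_mem {n : ℕ} {x : Fin n → ℝ} {i : ℕ} {t : ℝ} (ht : 0 ≤ t)
    (h : ((Finset.univ : Finset (Fin n)).filter (fun j => t < |x j|)).card ≤ i - 1) :
    rearr n x i ≤ t :=
  csInf_le ⟨0, fun _ hs => hs.1⟩ ⟨ht, h⟩

theorem norm_mem_rearr_set (n : ℕ) (x : Fin n → ℝ) (i : ℕ) :
    0 ≤ ‖x‖ ∧ ((Finset.univ : Finset (Fin n)).filter (fun j => ‖x‖ < |x j|)).card ≤ i - 1 := by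
  refine ⟨norm_nonneg x, ?_⟩
  rw [Finset.filter_false_of_mem]
  · simp
  · intro j _
    simpa using norm_le_pi_norm x j

theorem rearr_le_norm (n : ℕ) (x : Fin n → ℝ) (i : ℕ) : rearr n x i ≤ ‖x‖ :=
  rearr_le_of_mem (norm_mem_rearr_set n x i).1 (norm_mem_rearr_set n x i).2

theorem le_rearr {n : ℕ} {x : Fin n → ℝ} {i : ℕ} {r : ℝ}
    (h : ∀ t : ℝ, 0 ≤ t →
      ((Finset.univ : Finset (Fin n)).filter (fun j => t < |x j|)).card ≤ i - 1 → r ≤ t) :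
    r ≤ rearr n x i :=
  le_csInf ⟨_, norm_mem_rearr_set n x i⟩ fun t ht => h t ht.1 ht.2

theorem rearr_antitone (n : ℕ) (x : Fin n → ℝ) : Antitone (rearr n x) := by
  intro i j hij
  exact le_rearr fun t ht h => rearr_le_of_mem ht (h.trans (by omega))

theorem rearr_neg (n : ℕ) (x : Fin n → ℝ) (i : ℕ) : rearr n (-x) i = rearr n x i := by
  simp [rearr]

theorem rearr_add_le {n : ℕ} (x y : Fin n → ℝ) {i j m : ℕ} (hi : 1 ≤ i) (hj : 1 ≤ j)
    (hm : i + j ≤ m + 1) : rearr n (x + y) m ≤ rearr n x i + rearr n y j := by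
  rw [← sub_le_iff_le_add]
  refine le_rearr fun s hs hsx => ?_
  rw [sub_le_comm]
  refine le_rearr fun t ht hty => ?_
  rw [sub_le_iff_le_add']
  refine rearr_le_of_mem (by positivity) ?_
  have hsub : (Finset.univ.filter fun l => s + t < |(x + y) l|) ⊆
      (Finset.univ.filter fun l => s < |x l|) ∪ (Finset.univ.filter fun l => t < |y l|) := by
    intro l hl
    simp only [Finset.mem_filter, Finset.mem_univ, true_and, Finset.mem_union, Pi.add_apply] at hl ⊢
    by_contra! hcon
    linarith [abs_add_le (x l) (y l)]
  have := (Finset.card_le_card hsub).trans (Finset.card_union_le _ _)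
  omega

theorem rearr_smul_le {n : ℕ} (x : Fin n → ℝ) (i : ℕ) {c : ℝ} (hc : 0 < c) :
    rearr n (c • x) i ≤ c * rearr n x i := by
  rw [mul_comm, ← div_le_iff₀ hc]
  refine le_rearr fun t ht h => ?_
  rw [div_le_iff₀ hc]
  refine rearr_le_of_mem (by positivity) ?_
  simpa only [Pi.smul_apply, smul_eq_mul, abs_mul, abs_of_pos hc, mul_comm c,
    mul_lt_mul_iff_left₀ hc] using h

theorem rearr_smul {n : ℕ} (x : Fin n → ℝ) (i : ℕ) {c : ℝ} (hc : 0 < c) :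
    rearr n (c • x) i = c * rearr n x i := by
  refine le_antisymm (rearr_smul_le x i hc) ?_
  have h := rearr_smul_le (c • x) i (inv_pos.2 hc)
  rw [inv_smul_smul₀ hc.ne'] at h
  rwa [← le_inv_mul_iff₀ hc]

theorem continuous_rearr (n : ℕ) {i : ℕ} (hi : 1 ≤ i) : Continuous fun x => rearr n x i := by
  have key (x y : Fin n → ℝ) : rearr n x i - rearr n y i ≤ dist x y := by
    have h := rearr_add_le y (x - y) hi le_rfl (m := i) le_rfl
    rw [add_sub_cancel] at h
    rw [dist_eq_norm]
    linarith [rearr_le_norm n (x - y) 1]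
  refine (LipschitzWith.of_dist_le_mul (K := 1) fun x y => ?_).continuous
  rw [NNReal.coe_one, one_mul, Real.dist_eq]
  exact abs_sub_le_iff.2 ⟨key x y, by rw [dist_comm]; exact key y x⟩

theorem exists_perm_abs_le_rearr {n : ℕ} (x : Fin n → ℝ) :
    ∃ σ : Equiv.Perm (Fin n), ∀ i : Fin n, |x (σ i)| ≤ rearr n x (i + 1) := by
  let f : Fin n → ℝ := fun j => -|x j|
  refine ⟨Tuple.sort f, fun i => le_rearr fun t _ h => ?_⟩
  by_contra! hlt
  have hsub : (Finset.Iic i).image (Tuple.sort f) ⊆ Finset.univ.filter fun j => t < |x j| := by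
    intro l hl
    obtain ⟨j, hj, rfl⟩ := Finset.mem_image.1 hl
    have := Tuple.monotone_sort f (Finset.mem_Iic.1 hj)
    simp only [Function.comp_apply, f, neg_le_neg_iff] at this
    simpa using hlt.trans_le this
  have hcard := Finset.card_le_card hsub
  rw [Finset.card_image_of_injective _ (Tuple.sort f).injective, Fin.card_Iic] at hcard
  omega

open scoped Pointwise in
theorem volume_quasiBall {n : ℕ} {N : (Fin n → ℝ) → ℝ}
    (hN : ∀ (c : ℝ) (x : Fin n → ℝ), 0 < c → N (c • x) = c * N x) (y : Fin n → ℝ) {r : ℝ}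
    (hr : 0 < r) :
    volume {x | N (x - y) ≤ r} = ENNReal.ofReal (r ^ n) * volume {x | N x ≤ 1} := by
  have h1 : {x | N (x - y) ≤ r} = (fun x => x + -y) ⁻¹' (r • {x | N x ≤ 1}) := by
    ext x
    rw [Set.mem_preimage, Set.mem_smul_set_iff_inv_smul_mem₀ hr.ne', Set.mem_ofPred_eq,
      Set.mem_ofPred_eq, hN _ _ (inv_pos.2 hr), inv_mul_le_iff₀ hr, mul_one, sub_eq_add_neg]
  rw [h1, measure_preimage_add_right, Measure.addHaar_smul, Module.finrank_fin_fun,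
    abs_of_pos (by positivity)]

theorem two_rpow_neg_pow {n k : ℕ} (hn : 0 < n) (hk : 0 < k) :
    ((2 : ℝ) ^ (-((k : ℝ) - 1) / n)) ^ n * 2 ^ (k - 1) = 1 := by
  have hn' : (n : ℝ) ≠ 0 := by positivity
  rw [← Real.rpow_natCast, ← Real.rpow_mul (by norm_num), div_mul_cancel₀ _ hn',
    ← Real.rpow_natCast 2 (k - 1), ← Real.rpow_add (by norm_num), Nat.cast_sub hk]
  simp

theorem card_separated_le {n : ℕ} {N : (Fin n → ℝ) → ℝ} {K δ : ℝ} (hK : 1 ≤ K)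
    (hδ : 0 < δ) (hδ1 : δ ≤ 1)
    (hN : ∀ (c : ℝ) (x : Fin n → ℝ), 0 < c → N (c • x) = c * N x)
    (hneg : ∀ x, N (-x) = N x) (hadd : ∀ x y, N (x + y) ≤ K * (N x + N y))
    (hclosed : IsClosed {x | N x ≤ 1}) (hpos : volume {x | N x ≤ 1} ≠ 0)
    (hfin : volume {x | N x ≤ 1} ≠ ⊤) {S : Finset (Fin n → ℝ)} (hS : ∀ x ∈ S, N x ≤ 1)
    (hsep : ∀ x ∈ S, ∀ y ∈ S, x ≠ y → δ < N (x - y)) :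
    (S.card : ℝ) * δ ^ n ≤ (4 * K ^ 2) ^ n := by
  set η := δ / (2 * K) with hη
  have hη0 : 0 < η := by positivity
  have hη1 : η ≤ 1 := by rw [hη, div_le_one (by positivity)]; linarith
  have hmeas (y : Fin n → ℝ) : MeasurableSet {x | N (x - y) ≤ η} := by
    have : {x | N (x - y) ≤ η} = (fun x => η⁻¹ • (x - y)) ⁻¹' {x | N x ≤ 1} := by
      ext x
      rw [Set.mem_preimage, Set.mem_ofPred_eq, Set.mem_ofPred_eq, hN _ _ (inv_pos.2 hη0),
        inv_mul_le_iff₀ hη0, mul_one]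
    rw [this]
    exact (hclosed.preimage (by fun_prop)).measurableSet
  have hdisj : Set.PairwiseDisjoint (S : Set (Fin n → ℝ)) fun y => {x | N (x - y) ≤ η} := by
    intro y hy z hz hyz
    refine Set.disjoint_left.2 fun x hxy hxz => ?_
    rw [Set.mem_ofPred_eq] at hxy hxz
    have h1 := hadd (-(x - y)) (x - z)
    rw [hneg, show -(x - y) + (x - z) = y - z by abel] at h1
    have h2 : K * (N (x - y) + N (x - z)) ≤ K * (η + η) := by gcongr
    have h3 : K * (η + η) = δ := by rw [hη]; field_simp; ring
    linarith [hsep y hy z hz hyz]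
  have hsub : (⋃ y ∈ S, {x | N (x - y) ≤ η}) ⊆ {x | N (x - 0) ≤ 2 * K} := by
    refine Set.iUnion₂_subset fun y hy x hx => ?_
    rw [Set.mem_ofPred_eq] at hx ⊢
    have h1 := hadd (x - y) y
    rw [sub_add_cancel] at h1
    have h2 : K * (N (x - y) + N y) ≤ K * (1 + 1) := by
      gcongr
      · exact hx.trans hη1
      · exact hS y hy
    rw [sub_zero]; linarith
  have hvol := measure_mono (μ := volume) hsub
  rw [measure_biUnion_finset hdisj fun y _ => hmeas y, volume_quasiBall hN _ (by positivity)] at hvol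
  simp only [volume_quasiBall hN _ hη0, Finset.sum_const, nsmul_eq_mul] at hvol
  rw [← mul_assoc, ENNReal.mul_le_mul_iff_left hpos hfin, ← ENNReal.ofReal_natCast,
    ← ENNReal.ofReal_mul (by positivity), ENNReal.ofReal_le_ofReal_iff (by positivity)] at hvol
  calc (S.card : ℝ) * δ ^ n = S.card * η ^ n * (2 * K) ^ n := by
        rw [mul_assoc, ← mul_pow, hη]; congr 2; field_simp
    _ ≤ (2 * K) ^ n * (2 * K) ^ n := by gcongr
    _ = _ := by rw [← mul_pow]; congr 1; ring

theorem exists_cover {n k : ℕ} (hn : 0 < n) (hk : 0 < k) {N : (Fin n → ℝ) → ℝ} {K : ℝ}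
    (hK : 1 ≤ K) (hN : ∀ (c : ℝ) (x : Fin n → ℝ), 0 < c → N (c • x) = c * N x)
    (hneg : ∀ x, N (-x) = N x) (hadd : ∀ x y, N (x + y) ≤ K * (N x + N y))
    (hclosed : IsClosed {x | N x ≤ 1}) (hpos : volume {x | N x ≤ 1} ≠ 0)
    (hfin : volume {x | N x ≤ 1} ≠ ⊤) :
    ∃ T : Finset (Fin n → ℝ), T.card ≤ 2 ^ (k - 1) ∧ ∀ x, N x ≤ 1 →
      ∃ y ∈ T, N (x - y) ≤ 4 * K ^ 2 * (2 : ℝ) ^ (-((k : ℝ) - 1) / n) := by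
  set δ := 4 * K ^ 2 * (2 : ℝ) ^ (-((k : ℝ) - 1) / n) with hδ
  have hδ0 : 0 < δ := by positivity
  rcases lt_or_ge 1 δ with h1 | h1
  · exact ⟨{0}, by simpa using Nat.one_le_two_pow, fun x hx => ⟨0, by simp, by
      rw [sub_zero]; linarith⟩⟩
  let Sep : Finset (Fin n → ℝ) → Prop := fun S =>
    (∀ x ∈ S, N x ≤ 1) ∧ ∀ x ∈ S, ∀ y ∈ S, x ≠ y → δ < N (x - y)
  have hbound (S : Finset (Fin n → ℝ)) (hS : Sep S) : S.card ≤ 2 ^ (k - 1) := by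
    have h := card_separated_le hK hδ0 h1 hN hneg hadd hclosed hpos hfin hS.1 hS.2
    have h2 := two_rpow_neg_pow hn hk
    rw [hδ, mul_pow (4 * K ^ 2)] at h
    have hp : (0 : ℝ) < (4 * K ^ 2) ^ n := by positivity
    have h3 : (S.card : ℝ) * ((2 : ℝ) ^ (-((k : ℝ) - 1) / n)) ^ n ≤ 1 := by
      refine le_of_mul_le_mul_left ?_ hp
      linarith
    have h4 : (S.card : ℝ) ≤ 2 ^ (k - 1) := by
      calc (S.card : ℝ) = S.card * ((2 : ℝ) ^ (-((k : ℝ) - 1) / n)) ^ n * 2 ^ (k - 1) := by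
            rw [mul_assoc, h2, mul_one]
        _ ≤ 1 * 2 ^ (k - 1) := by gcongr
        _ = _ := one_mul _
    exact_mod_cast h4
  obtain ⟨m, ⟨S, hS, hSm⟩, hmax⟩ : ∃ m, (∃ S, Sep S ∧ S.card = m) ∧
      ∀ m', (∃ S, Sep S ∧ S.card = m') → m' ≤ m := by
    let Q : ℕ → Prop := fun m => ∃ S, Sep S ∧ S.card = m
    have hQ0 : Q 0 := ⟨∅, by simp [Sep], rfl⟩
    refine ⟨Nat.findGreatest Q (2 ^ (k - 1)), Nat.findGreatest_spec (Nat.zero_le _) hQ0, ?_⟩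
    rintro m' ⟨S, hS, rfl⟩
    exact Nat.le_findGreatest (hbound S hS) ⟨S, hS, rfl⟩
  refine ⟨S, hbound S hS, fun x hx => ?_⟩
  by_contra! hcon
  have hxS : x ∉ S := fun hxS => by
    have h0 : N 0 = 0 := by
      have := hN 2 0 two_pos
      rw [smul_zero] at this; linarith
    have := hcon x hxS
    rw [sub_self, h0] at this
    linarith
  have hins : Sep (insert x S) := by
    refine ⟨fun z hz => ?_, fun y hy z hz hyz => ?_⟩
    · rcases Finset.mem_insert.1 hz with rfl | hz
      exacts [hx, hS.1 z hz]
    · rcases Finset.mem_insert.1 hy with hyx | hyS <;>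
        rcases Finset.mem_insert.1 hz with hzx | hzS
      · exact absurd (hyx.trans hzx.symm) hyz
      · rw [hyx]; exact hcon z hzS
      · rw [hzx, ← hneg, neg_sub]; exact hcon y hyS
      · exact hS.2 y hyS z hzS hyz
  have := hmax _ ⟨_, hins, rfl⟩
  rw [Finset.card_insert_of_notMem hxS] at this
  omega

theorem le_of_cover {n k : ℕ} (hn : 0 < n) (hk : 0 < k) {NX NY : (Fin n → ℝ) → ℝ}
    {ρ σ ε : ℝ} (hρ : 0 < ρ) (hσ : 0 < σ) (hε : 0 < ε)
    (hcube : ∀ x, ‖x‖ ≤ ρ → NX x ≤ 1)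
    (hNY : ∀ (c : ℝ) (x : Fin n → ℝ), 0 < c → NY (c • x) = c * NY x)
    (hvol : volume {x | NY x ≤ 1} ≤ ENNReal.ofReal (σ ^ n))
    {T : Finset (Fin n → ℝ)} (hT : T.card ≤ 2 ^ (k - 1))
    (hcover : ∀ x, NX x ≤ 1 → ∃ y ∈ T, NY (x - y) ≤ ε) :
    2 * ρ / σ * (2 : ℝ) ^ (-((k : ℝ) - 1) / n) ≤ ε := by
  have hsub : Metric.closedBall (0 : Fin n → ℝ) ρ ⊆ ⋃ y ∈ T, {x | NY (x - y) ≤ ε} := by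
    intro x hx
    obtain ⟨y, hy, hxy⟩ := hcover x (hcube x (mem_closedBall_zero_iff.1 hx))
    exact Set.mem_biUnion hy hxy
  have h := (measure_mono (μ := volume) hsub).trans (measure_biUnion_finset_le _ _)
  simp only [volume_quasiBall hNY _ hε, Finset.sum_const, nsmul_eq_mul] at h
  rw [Real.volume_pi_closedBall _ hρ.le, Fintype.card_fin] at h
  have h' : ENNReal.ofReal ((2 * ρ) ^ n) ≤ ENNReal.ofReal (2 ^ (k - 1) * (ε ^ n * σ ^ n)) := by
    rw [ENNReal.ofReal_mul (by positivity), ENNReal.ofReal_mul (by positivity)]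
    refine h.trans ?_
    gcongr
    rw [← ENNReal.ofReal_natCast]
    exact ENNReal.ofReal_le_ofReal (by exact_mod_cast hT)
  rw [ENNReal.ofReal_le_ofReal_iff (by positivity)] at h'
  rw [div_mul_eq_mul_div, div_le_iff₀ hσ]
  refine le_of_pow_le_pow_left₀ hn.ne' (by positivity) ?_
  have h2 := two_rpow_neg_pow hn hk
  calc (2 * ρ * (2 : ℝ) ^ (-((k : ℝ) - 1) / n)) ^ n
      = (2 * ρ) ^ n * ((2 : ℝ) ^ (-((k : ℝ) - 1) / n)) ^ n := mul_pow _ _ _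
    _ ≤ 2 ^ (k - 1) * (ε ^ n * σ ^ n) * ((2 : ℝ) ^ (-((k : ℝ) - 1) / n)) ^ n := by gcongr
    _ = (((2 : ℝ) ^ (-((k : ℝ) - 1) / n)) ^ n * 2 ^ (k - 1)) * (ε * σ) ^ n := by
        rw [mul_pow]; ring
    _ = (ε * σ) ^ n := by rw [h2, one_mul]

theorem prod_natCast_div_succ_rpow_le (n : ℕ) (hn : 0 < n) {s : ℝ} (hs : 0 ≤ s) :
    ∏ i : Fin n, (((n : ℝ) / ((i : ℕ) + 1 : ℝ)) ^ s) ≤ (Real.exp s) ^ n := by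
  rw [Real.finsetProd_rpow _ _ fun i _ => by positivity, Finset.prod_div_distrib,
    Finset.prod_const, Finset.card_univ, Fintype.card_fin,
    Fin.prod_univ_eq_prod_range (fun i => ((i : ℝ) + 1)) n]
  have hfact : ∏ i ∈ Finset.range n, ((i : ℝ) + 1) = (n.factorial : ℝ) := by
    rw [← Finset.prod_range_add_one_eq_factorial]; push_cast; rfl
  rw [hfact, ← Real.exp_nat_mul, Real.exp_mul]
  gcongr
  exact Real.pow_div_factorial_le_exp _ (by positivity) n

theorem volume_rearr_le (n : ℕ) (hn : 0 < n) {s : ℝ} (hs : 0 ≤ s) :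
    volume {x : Fin n → ℝ | ∀ i ∈ Finset.Icc 1 n, (i : ℝ) ^ s * rearr n x i ≤ (n : ℝ) ^ s} ≤
      ENNReal.ofReal ((2 * Real.pi * Real.exp (2 * s)) ^ n) := by
  set g : (Fin n → ℝ) → ℝ := fun x => ∏ j, (1 + x j ^ 2)⁻¹ with hg
  set D : ℝ := (2 * Real.exp (2 * s)) ^ n with hD
  have hD0 : 0 < D := by positivity
  have hg0 (x) : 0 ≤ g x := Finset.prod_nonneg fun j _ => by positivity
  have hint : Integrable g := Integrable.fintype_prod fun _ => integrable_inv_one_add_sq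
  have hgint : ∫ x, g x = Real.pi ^ n := by
    rw [hg, integral_fintype_prod_volume_eq_pow fun x : ℝ => (1 + x ^ 2)⁻¹,
      integral_univ_inv_one_add_sq, Fintype.card_fin]
  have hsub : {x : Fin n → ℝ | ∀ i ∈ Finset.Icc 1 n, (i : ℝ) ^ s * rearr n x i ≤ (n : ℝ) ^ s} ⊆
      {x | ENNReal.ofReal D⁻¹ ≤ ENNReal.ofReal (g x)} := by
    intro x hx
    refine ENNReal.ofReal_le_ofReal ?_
    rw [hg]
    simp only [Finset.prod_inv_distrib]
    refine inv_anti₀ (Finset.prod_pos fun j _ => by positivity) ?_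
    obtain ⟨σ, hσ⟩ := exists_perm_abs_le_rearr x
    rw [← Equiv.prod_comp σ]
    calc ∏ i, (1 + x (σ i) ^ 2)
        ≤ ∏ i : Fin n, 2 * ((n : ℝ) / ((i : ℕ) + 1 : ℝ)) ^ (2 * s) := by
          refine Finset.prod_le_prod (fun i _ => by positivity) fun i _ => ?_
          have hi : ((i : ℕ) : ℝ) + 1 ≤ n := by exact_mod_cast i.2
          have h1 : 1 ≤ (n : ℝ) / ((i : ℕ) + 1 : ℝ) := by
            rwa [one_le_div (by positivity)]
          have h2 := hx (i + 1) (Finset.mem_Icc.2 ⟨by omega, i.2⟩)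
          push_cast at h2
          have h3 : |x (σ i)| ≤ ((n : ℝ) / ((i : ℕ) + 1 : ℝ)) ^ s := by
            rw [Real.div_rpow (by positivity) (by positivity), le_div_iff₀' (by positivity)]
            exact le_trans (by gcongr; exact hσ i) h2
          have h4 : x (σ i) ^ 2 ≤ ((n : ℝ) / ((i : ℕ) + 1 : ℝ)) ^ (2 * s) := by
            rw [mul_comm, Real.rpow_mul (by positivity), Real.rpow_two, ← sq_abs]
            gcongr
          have h5 := Real.one_le_rpow h1 (z := 2 * s) (by positivity)
          linarith
      _ ≤ D := by
          rw [Finset.prod_mul_distrib, hD, mul_pow, Finset.prod_const, Finset.card_univ,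
            Fintype.card_fin]
          gcongr
          exact prod_natCast_div_succ_rpow_le n hn (by positivity)
  have hmarkov := meas_ge_le_lintegral_div (μ := volume) (f := fun x => ENNReal.ofReal (g x))
    hint.aestronglyMeasurable.aemeasurable.ennreal_ofReal
    (ε := ENNReal.ofReal D⁻¹) (by simpa using hD0) ENNReal.ofReal_ne_top
  rw [← ofReal_integral_eq_lintegral_ofReal hint (ae_of_all _ hg0), hgint,
    ← ENNReal.ofReal_div_of_pos (by positivity)] at hmarkov
  refine (measure_mono hsub).trans (hmarkov.trans_eq ?_)
  congr 1
  rw [div_inv_eq_mul, hD, ← mul_pow]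
  congr 1; ring

/-- The two-sided control on a quasi-norm that determines its entropy numbers up to constants. -/
structure LorentzBounds (n : ℕ) (N : (Fin n → ℝ) → ℝ) (K q : ℝ) : Prop where
  nonneg : ∀ x, 0 ≤ N x
  smul : ∀ (c : ℝ) (x : Fin n → ℝ), 0 < c → N (c • x) = c * N x
  neg : ∀ x, N (-x) = N x
  add : ∀ x y, N (x + y) ≤ K * (N x + N y)
  closed : IsClosed {x | N x ≤ 1}
  le_norm : ∀ x, N x ≤ K * (n : ℝ) ^ q * ‖x‖
  rearr_le : ∀ x, ∀ i ∈ Finset.Icc 1 n, (i : ℝ) ^ q * rearr n x i ≤ K * N x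

/-- The sum defining the Lorentz quasi-norm with fundamental exponent `q = 1/p`. -/
noncomputable def lorentzSum (n : ℕ) (q U : ℝ) (x : Fin n → ℝ) : ℝ :=
  ∑ i ∈ Finset.Icc 1 n, (i : ℝ) ^ (U * q - 1) * rearr n x i ^ U

theorem lorentzNorm_of_ne_top (n : ℕ) {p u : ℝ≥0∞} (hu : u ≠ ⊤) (x : Fin n → ℝ) :
    lorentzNorm n p u x = lorentzSum n (1 / p).toReal u.toReal x ^ (1 / u.toReal) := by
  rw [lorentzNorm, if_neg hu, lorentzSum]
  simp only [div_eq_mul_inv, one_mul, ENNReal.toReal_mul]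

theorem lorentzSum_nonneg (n : ℕ) (q U : ℝ) (x : Fin n → ℝ) : 0 ≤ lorentzSum n q U x :=
  Finset.sum_nonneg fun i _ =>
    mul_nonneg (by positivity) (Real.rpow_nonneg (rearr_nonneg n x i) _)

theorem lorentzNorm_top_le_iff {n : ℕ} (hn : 0 < n) (p : ℝ≥0∞) (x : Fin n → ℝ) (r : ℝ) :
    lorentzNorm n p ⊤ x ≤ r ↔
      ∀ i ∈ Finset.Icc 1 n, (i : ℝ) ^ (1 / p).toReal * rearr n x i ≤ r := by
  rw [lorentzNorm, if_pos rfl]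
  have hset : {t : ℝ | ∃ i ∈ Finset.Icc 1 n, t = (i : ℝ) ^ (1 / p).toReal * rearr n x i} =
      (fun i : ℕ => (i : ℝ) ^ (1 / p).toReal * rearr n x i) '' (Finset.Icc 1 n : Set ℕ) := by
    ext t
    simp [eq_comm]
  rw [hset, csSup_le_iff ((Finset.finite_toSet _).image _).bddAbove
    (Set.Nonempty.image _ ⟨1, Finset.mem_coe.2 (Finset.mem_Icc.2 ⟨le_rfl, hn⟩)⟩), Set.forall_mem_image]
  rfl

theorem mul_rearr_le_lorentzNorm_top {n : ℕ} (p : ℝ≥0∞) (x : Fin n → ℝ) {i : ℕ}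
    (hi : i ∈ Finset.Icc 1 n) :
    (i : ℝ) ^ (1 / p).toReal * rearr n x i ≤ lorentzNorm n p ⊤ x :=
  (lorentzNorm_top_le_iff ((Finset.mem_Icc.1 hi).1.trans (Finset.mem_Icc.1 hi).2) p x _).1 le_rfl
    i hi

theorem sum_half_le (n : ℕ) {f : ℕ → ℝ} (hf : ∀ i, 0 ≤ f i) :
    ∑ i ∈ Finset.Icc 1 n, f ((i + 1) / 2) ≤ 2 * ∑ m ∈ Finset.Icc 1 n, f m := by
  rw [← Finset.sum_fiberwise_of_maps_to (g := fun i => (i + 1) / 2) (t := Finset.Icc 1 n),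
    Finset.mul_sum]
  · refine Finset.sum_le_sum fun m _ => ?_
    rw [Finset.sum_congr rfl fun i hi => by rw [(Finset.mem_filter.1 hi).2], Finset.sum_const,
      nsmul_eq_mul]
    refine mul_le_mul_of_nonneg_right ?_ (hf m)
    have hsub : (Finset.Icc 1 n).filter (fun i => (i + 1) / 2 = m) ⊆ {2 * m - 1, 2 * m} := by
      intro i hi
      simp only [Finset.mem_filter, Finset.mem_Icc, Finset.mem_insert, Finset.mem_singleton] at hi ⊢
      omega
    exact_mod_cast (Finset.card_le_card hsub).trans Finset.card_le_two
  · intro i hi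
    simp only [Finset.mem_Icc] at hi ⊢
    omega

theorem rpow_sub_one_le_half {a : ℝ} (ha : 0 < a) {i : ℕ} (hi : 1 ≤ i) :
    (i : ℝ) ^ (a - 1) ≤ 2 ^ a * (((i + 1) / 2 : ℕ) : ℝ) ^ (a - 1) := by
  have h1 : 1 ≤ (i + 1) / 2 := by omega
  have h2 : (i + 1) / 2 ≤ i := by omega
  have h3 : i ≤ 2 * ((i + 1) / 2) := by omega
  set m := (i + 1) / 2
  have hm : (0 : ℝ) < m := by exact_mod_cast h1
  have hi0 : (0 : ℝ) < i := by exact_mod_cast hi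
  rw [Real.rpow_sub_one hi0.ne', Real.rpow_sub_one hm.ne', ← mul_div_assoc,
    ← Real.mul_rpow (by norm_num) hm.le]
  gcongr
  exact_mod_cast h3

theorem le_sum_rpow_sub_one {a : ℝ} (ha : 0 < a) (i : ℕ) (hi : 1 ≤ i) :
    (i : ℝ) ^ a ≤ 2 ^ (a + 1) * ∑ m ∈ Finset.Icc 1 i, (m : ℝ) ^ (a - 1) := by
  have hi0 : (0 : ℝ) < i := by exact_mod_cast hi
  have hsub : Finset.Icc ((i + 1) / 2) i ⊆ Finset.Icc 1 i :=
    Finset.Icc_subset_Icc_left (by omega)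
  have hterm : ∀ m ∈ Finset.Icc ((i + 1) / 2) i, ((i : ℝ) / 2) ^ a / i ≤ (m : ℝ) ^ (a - 1) := by
    intro m hm
    rw [Finset.mem_Icc] at hm
    have hm1 : 1 ≤ m := by omega
    have hm0 : (0 : ℝ) < m := by exact_mod_cast hm1
    have h2 : (i : ℝ) / 2 ≤ m := by
      rw [div_le_iff₀ two_pos]
      exact_mod_cast (by omega : i ≤ m * 2)
    rw [Real.rpow_sub_one hm0.ne']
    gcongr
    exact hm.2
  have hcard : (i : ℝ) / 2 ≤ (Finset.Icc ((i + 1) / 2) i).card := by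
    rw [Nat.card_Icc, div_le_iff₀ two_pos]
    exact_mod_cast (by omega : i ≤ (i + 1 - (i + 1) / 2) * 2)
  calc (i : ℝ) ^ a = 2 ^ (a + 1) * ((i : ℝ) / 2 * (((i : ℝ) / 2) ^ a / i)) := by
        rw [Real.rpow_add_one (by norm_num), Real.div_rpow hi0.le (by norm_num)]
        field_simp
    _ ≤ 2 ^ (a + 1) * ∑ m ∈ Finset.Icc ((i + 1) / 2) i, (m : ℝ) ^ (a - 1) := by
        gcongr
        refine le_trans ?_ (Finset.card_nsmul_le_sum _ _ _ hterm)
        rw [nsmul_eq_mul]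
        gcongr
    _ ≤ _ := by
        gcongr

theorem sum_rpow_sub_one_le {a : ℝ} (ha : 0 < a) (n : ℕ) :
    ∑ i ∈ Finset.Icc 1 n, (i : ℝ) ^ (a - 1) ≤ (1 + 1 / a) * (n : ℝ) ^ a := by
  have key : ∀ n : ℕ, ((n + 1 : ℕ) : ℝ) ^ (a - 1) ≤
      (1 + 1 / a) * (((n + 1 : ℕ) : ℝ) ^ a - (n : ℝ) ^ a) := by
    intro n
    have hn0 : (0 : ℝ) < ((n + 1 : ℕ) : ℝ) := by positivity
    have hfrac : (n : ℝ) = (n + 1 : ℕ) * (1 + -1 / ((n + 1 : ℕ) : ℝ)) := by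
      field_simp; push_cast; ring
    have hs : -1 ≤ -1 / ((n + 1 : ℕ) : ℝ) := by
      rw [le_div_iff₀ hn0]; push_cast; linarith [(Nat.cast_nonneg n : (0 : ℝ) ≤ n)]
    have hb : (1 + -1 / ((n + 1 : ℕ) : ℝ)) ^ a ≤ 1 + min a 1 * (-1 / ((n + 1 : ℕ) : ℝ)) := by
      rcases le_total a 1 with h | h
      · rw [min_eq_left h]; exact rpow_one_add_le_one_add_mul_self hs ha.le h
      · rw [min_eq_right h, one_mul]
        refine (Real.rpow_le_rpow_of_exponent_ge' (by linarith) ?_ zero_le_one h).trans_eq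
          (Real.rpow_one _)
        have : -1 / ((n + 1 : ℕ) : ℝ) ≤ 0 := div_nonpos_of_nonpos_of_nonneg (by norm_num) hn0.le
        linarith
    have hmin : 1 ≤ (1 + 1 / a) * min a 1 := by
      rcases le_total a 1 with h | h
      · rw [min_eq_left h]; field_simp; linarith
      · rw [min_eq_right h]; have := one_div_pos.2 ha; linarith
    have h2 : (n : ℝ) ^ a = ((n + 1 : ℕ) : ℝ) ^ a * (1 + -1 / ((n + 1 : ℕ) : ℝ)) ^ a := by
      rw [← Real.mul_rpow hn0.le (by linarith), ← hfrac]
    rw [h2, Real.rpow_sub_one hn0.ne']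
    have h3 : 0 < ((n + 1 : ℕ) : ℝ) ^ a := by positivity
    have ha1 : 0 < 1 + 1 / a := by positivity
    calc ((n + 1 : ℕ) : ℝ) ^ a / ((n + 1 : ℕ) : ℝ)
        ≤ ((1 + 1 / a) * min a 1) * (((n + 1 : ℕ) : ℝ) ^ a / ((n + 1 : ℕ) : ℝ)) :=
          le_mul_of_one_le_left (by positivity) hmin
      _ = (1 + 1 / a) * (((n + 1 : ℕ) : ℝ) ^ a -
            ((n + 1 : ℕ) : ℝ) ^ a * (1 + min a 1 * (-1 / ((n + 1 : ℕ) : ℝ)))) := by ring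
      _ ≤ _ := by gcongr
  induction n with
  | zero => simp [Real.zero_rpow ha.ne']
  | succ n ih =>
    rw [Finset.sum_Icc_succ_top (by omega)]
    linarith [key n]

theorem lorentzSum_add_le {n : ℕ} {q U : ℝ} (hq : 0 < q) (hU : 0 < U) (x y : Fin n → ℝ) :
    lorentzSum n q U (x + y) ≤
      2 ^ U * 2 ^ (U * q) * 2 * (lorentzSum n q U x + lorentzSum n q U y) := by
  have ha : 0 < U * q := by positivity
  set f : ℕ → ℝ := fun m => (m : ℝ) ^ (U * q - 1) * (rearr n x m ^ U + rearr n y m ^ U) with hf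
  have hr (z : Fin n → ℝ) (m : ℕ) : 0 ≤ rearr n z m ^ U := Real.rpow_nonneg (rearr_nonneg n z m) _
  have hf0 (m : ℕ) : 0 ≤ f m :=
    mul_nonneg (by positivity) (add_nonneg (hr x m) (hr y m))
  have hsum : lorentzSum n q U x + lorentzSum n q U y = ∑ m ∈ Finset.Icc 1 n, f m := by
    simp only [lorentzSum, hf, mul_add, Finset.sum_add_distrib]
  rw [hsum, mul_assoc]
  refine le_trans ?_ (mul_le_mul_of_nonneg_left (sum_half_le n hf0) (by positivity))
  rw [lorentzSum, Finset.mul_sum]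
  refine Finset.sum_le_sum fun i hi => ?_
  have hi1 := (Finset.mem_Icc.1 hi).1
  have hw := rpow_sub_one_le_half ha hi1
  have hxy := rearr_add_le x y (i := (i + 1) / 2) (j := (i + 1) / 2) (m := i) (by omega) (by omega)
    (by omega)
  set m := (i + 1) / 2
  have hpow : rearr n (x + y) i ^ U ≤ 2 ^ U * (rearr n x m ^ U + rearr n y m ^ U) := by
    have h1 : rearr n (x + y) i ≤ 2 * max (rearr n x m) (rearr n y m) := by
      linarith [le_max_left (rearr n x m) (rearr n y m), le_max_right (rearr n x m) (rearr n y m)]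
    have hmax : 0 ≤ max (rearr n x m) (rearr n y m) := (rearr_nonneg n x m).trans (le_max_left _ _)
    refine (Real.rpow_le_rpow (rearr_nonneg _ _ _) h1 hU.le).trans ?_
    rw [Real.mul_rpow (by norm_num) hmax]
    gcongr
    rcases max_choice (rearr n x m) (rearr n y m) with h | h <;> rw [h]
    · linarith [hr y m]
    · linarith [hr x m]
  calc (i : ℝ) ^ (U * q - 1) * rearr n (x + y) i ^ U
      ≤ (2 ^ (U * q) * (m : ℝ) ^ (U * q - 1)) *
          (2 ^ U * (rearr n x m ^ U + rearr n y m ^ U)) :=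
        mul_le_mul hw hpow (hr _ _) (by positivity)
    _ = 2 ^ U * 2 ^ (U * q) * f m := by rw [hf]; ring

theorem lorentzBounds_of_ne_top {p u : ℝ≥0∞} (hp : 0 < (1 / p).toReal) (hu : 0 < u)
    (hu' : u ≠ ⊤) :
    ∃ K : ℝ, 1 ≤ K ∧ ∀ n : ℕ, 0 < n →
      LorentzBounds n (lorentzNorm n p u) K (1 / p).toReal := by
  set q := (1 / p).toReal with hq
  set U := u.toReal with hUdef
  have hU : 0 < U := ENNReal.toReal_pos hu.ne' hu'
  have ha : 0 < U * q := by positivity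
  have hN (n : ℕ) (x : Fin n → ℝ) : lorentzNorm n p u x = lorentzSum n q U x ^ (1 / U) :=
    lorentzNorm_of_ne_top n hu' x
  set K₁ : ℝ := (2 ^ U * 2 ^ (U * q) * 2 * 2) ^ (1 / U)
  set K₂ : ℝ := (1 + 1 / (U * q)) ^ (1 / U)
  set K₃ : ℝ := (2 ^ (U * q + 1)) ^ (1 / U)
  have hK₁ : 0 < K₁ := by positivity
  have hK₂ : 0 < K₂ := by positivity
  have hK₃ : 0 < K₃ := by positivity
  have hpow (t : ℝ) (ht : 0 ≤ t) : (t ^ U) ^ (1 / U) = t := by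
    rw [one_div, Real.rpow_rpow_inv ht hU.ne']
  have hnn (n : ℕ) (x : Fin n → ℝ) : 0 ≤ lorentzNorm n p u x := by
    rw [hN]; exact Real.rpow_nonneg (lorentzSum_nonneg _ _ _ _) _
  refine ⟨1 + K₁ + K₂ + K₃, by linarith, fun n hn => ⟨hnn n, ?_, ?_, ?_, ?_, ?_, ?_⟩⟩
  · intro c x hc
    have hs : lorentzSum n q U (c • x) = c ^ U * lorentzSum n q U x := by
      simp only [lorentzSum, Finset.mul_sum, rearr_smul x _ hc]
      refine Finset.sum_congr rfl fun i _ => ?_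
      rw [Real.mul_rpow hc.le (rearr_nonneg _ _ _)]; ring
    rw [hN, hN, hs, Real.mul_rpow (by positivity) (lorentzSum_nonneg _ _ _ _), hpow c hc.le]
  · intro x
    simp only [hN, lorentzSum, rearr_neg]
  · intro x y
    refine le_trans ?_ (mul_le_mul_of_nonneg_right (by linarith : K₁ ≤ _)
      (add_nonneg (hnn n x) (hnn n y)))
    rw [hN, hN, hN]
    set a := lorentzSum n q U x
    set b := lorentzSum n q U y
    have ha0 : 0 ≤ a := lorentzSum_nonneg _ _ _ _
    have hb0 : 0 ≤ b := lorentzSum_nonneg _ _ _ _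
    have hm0 : 0 ≤ max a b := ha0.trans (le_max_left _ _)
    have h1 : lorentzSum n q U (x + y) ≤ 2 ^ U * 2 ^ (U * q) * 2 * 2 * max a b := by
      refine (lorentzSum_add_le hp hU x y).trans ?_
      rw [mul_assoc (2 ^ U * 2 ^ (U * q) * 2)]
      gcongr
      linarith [le_max_left a b, le_max_right a b]
    refine (Real.rpow_le_rpow (lorentzSum_nonneg _ _ _ _) h1 (by positivity)).trans ?_
    rw [Real.mul_rpow (by positivity) hm0]
    refine mul_le_mul_of_nonneg_left ?_ hK₁.le
    have := Real.rpow_nonneg ha0 (1 / U)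
    have := Real.rpow_nonneg hb0 (1 / U)
    rcases max_choice a b with h | h <;> rw [h] <;> linarith
  · refine isClosed_le ?_ continuous_const
    rw [show lorentzNorm n p u = _ from funext (hN n)]
    refine Continuous.rpow_const (continuous_finsetSum _ fun i hi => ?_) fun _ =>
      Or.inr (by positivity)
    exact continuous_const.mul ((continuous_rearr n (Finset.mem_Icc.1 hi).1).rpow_const fun _ =>
      Or.inr hU.le)
  · intro x
    have h1 : lorentzSum n q U x ≤ (1 + 1 / (U * q)) * (n : ℝ) ^ (U * q) * ‖x‖ ^ U := by
      refine le_trans ?_ (mul_le_mul_of_nonneg_right (sum_rpow_sub_one_le ha n) (by positivity))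
      rw [lorentzSum, Finset.sum_mul]
      refine Finset.sum_le_sum fun i _ => ?_
      gcongr
      · exact rearr_nonneg _ _ _
      · exact rearr_le_norm n x i
    rw [hN]
    refine (Real.rpow_le_rpow (lorentzSum_nonneg _ _ _ _) h1 (by positivity)).trans ?_
    rw [Real.mul_rpow (by positivity) (by positivity), Real.mul_rpow (by positivity)
      (by positivity), hpow _ (norm_nonneg x), mul_comm U q, Real.rpow_mul (by positivity),
      hpow _ (by positivity)]
    gcongr
    rw [mul_comm q U]
    linarith
  · intro x i hi
    obtain ⟨hi1, hin⟩ := Finset.mem_Icc.1 hi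
    refine le_trans ?_ (mul_le_mul_of_nonneg_right (by linarith : K₃ ≤ _) (hnn n x))
    have hr := rearr_nonneg n x i
    have h1 : (i : ℝ) ^ (U * q) * rearr n x i ^ U ≤ 2 ^ (U * q + 1) * lorentzSum n q U x := by
      refine (mul_le_mul_of_nonneg_right (le_sum_rpow_sub_one ha i hi1)
        (Real.rpow_nonneg hr _)).trans ?_
      rw [mul_assoc, Finset.sum_mul]
      gcongr
      calc ∑ m ∈ Finset.Icc 1 i, (m : ℝ) ^ (U * q - 1) * rearr n x i ^ U
          ≤ ∑ m ∈ Finset.Icc 1 i, (m : ℝ) ^ (U * q - 1) * rearr n x m ^ U := by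
            refine Finset.sum_le_sum fun m hm => ?_
            gcongr
            exact rearr_antitone n x (Finset.mem_Icc.1 hm).2
        _ ≤ lorentzSum n q U x := by
            refine Finset.sum_le_sum_of_subset_of_nonneg (Finset.Icc_subset_Icc_right hin)
              fun m _ _ => ?_
            exact mul_nonneg (by positivity) (Real.rpow_nonneg (rearr_nonneg _ _ _) _)
    have h2 := Real.rpow_le_rpow (by positivity) h1 (by positivity : 0 ≤ 1 / U)
    rw [Real.mul_rpow (by positivity) (by positivity), hpow _ hr, mul_comm U q,
      Real.rpow_mul (by positivity), hpow _ (by positivity), Real.mul_rpow (by positivity)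
      (lorentzSum_nonneg _ _ _ _), mul_comm q U] at h2
    rw [hN]
    exact h2

theorem lorentzBounds_top {p : ℝ≥0∞} (n : ℕ) (hn : 0 < n) (hp : 0 < (1 / p).toReal) :
    LorentzBounds n (lorentzNorm n p ⊤) (2 ^ (1 / p).toReal) (1 / p).toReal := by
  set q := (1 / p).toReal with hq
  have h1 : (1 : ℝ) ≤ 2 ^ q := Real.one_le_rpow (by norm_num) hp.le
  have hnn (x : Fin n → ℝ) : 0 ≤ lorentzNorm n p ⊤ x :=
    (mul_nonneg (by positivity) (rearr_nonneg n x 1)).trans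
      (mul_rearr_le_lorentzNorm_top p x (Finset.mem_Icc.2 ⟨le_rfl, hn⟩))
  have hle (c : ℝ) (x : Fin n → ℝ) (hc : 0 < c) :
      lorentzNorm n p ⊤ (c • x) ≤ c * lorentzNorm n p ⊤ x := by
    rw [lorentzNorm_top_le_iff hn]
    intro i hi
    rw [rearr_smul x i hc, mul_left_comm]
    gcongr
    exact mul_rearr_le_lorentzNorm_top p x hi
  refine ⟨hnn, ?_, ?_, ?_, ?_, ?_, ?_⟩
  · intro c x hc
    refine le_antisymm (hle c x hc) ?_
    have h := hle c⁻¹ (c • x) (inv_pos.2 hc)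
    rwa [inv_smul_smul₀ hc.ne', le_inv_mul_iff₀ hc] at h
  · intro x
    simp only [lorentzNorm, rearr_neg]
  · intro x y
    rw [lorentzNorm_top_le_iff hn]
    intro i hi
    have hi' := Finset.mem_Icc.1 hi
    have hm : (i + 1) / 2 ∈ Finset.Icc 1 n := Finset.mem_Icc.2 (by omega)
    have hxy := rearr_add_le x y (i := (i + 1) / 2) (j := (i + 1) / 2) (m := i) (by omega)
      (by omega) (by omega)
    have h2 : (i : ℝ) ≤ 2 * ((i + 1) / 2 : ℕ) := by
      exact_mod_cast (by omega : i ≤ 2 * ((i + 1) / 2))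
    have hX := mul_rearr_le_lorentzNorm_top p x hm
    have hY := mul_rearr_le_lorentzNorm_top p y hm
    set m := (i + 1) / 2
    calc (i : ℝ) ^ q * rearr n (x + y) i
        ≤ (2 * m) ^ q * (rearr n x m + rearr n y m) := by
          gcongr
          exact rearr_nonneg _ _ _
      _ = 2 ^ q * ((m : ℝ) ^ q * rearr n x m + (m : ℝ) ^ q * rearr n y m) := by
          rw [Real.mul_rpow (by norm_num) (by positivity)]; ring
      _ ≤ _ := by gcongr
  · simp only [lorentzNorm_top_le_iff hn, Set.ofPred_forall]
    refine isClosed_iInter fun i => isClosed_iInter fun hi => ?_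
    exact isClosed_le (continuous_const.mul (continuous_rearr n (Finset.mem_Icc.1 hi).1))
      continuous_const
  · intro x
    rw [lorentzNorm_top_le_iff hn]
    intro i hi
    rw [mul_assoc]
    refine le_trans ?_ (le_mul_of_one_le_left (by positivity) h1)
    gcongr
    · exact rearr_nonneg _ _ _
    · exact (Finset.mem_Icc.1 hi).2
    · exact rearr_le_norm _ _ _
  · intro x i hi
    exact (mul_rearr_le_lorentzNorm_top p x hi).trans (le_mul_of_one_le_left (hnn x) h1)

theorem exists_lorentzBounds {p u : ℝ≥0∞} (hp : 0 < (1 / p).toReal) (hu : 0 < u) :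
    ∃ K : ℝ, 1 ≤ K ∧ ∀ n : ℕ, 0 < n →
      LorentzBounds n (lorentzNorm n p u) K (1 / p).toReal := by
  rcases eq_or_ne u ⊤ with rfl | hu'
  · exact ⟨_, Real.one_le_rpow (by norm_num) hp.le, fun n hn => lorentzBounds_top n hn hp⟩
  · exact lorentzBounds_of_ne_top hp hu hu'

theorem lorentzNorm_le_of_le {p u v : ℝ≥0∞} (hu : 0 < u) (huv : u ≤ v) {K : ℝ} (hK : 1 ≤ K)
    {n : ℕ} (hn : 0 < n) (h : LorentzBounds n (lorentzNorm n p u) K (1 / p).toReal)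
    (x : Fin n → ℝ) : lorentzNorm n p v x ≤ K * lorentzNorm n p u x := by
  rcases eq_or_ne v ⊤ with rfl | hv
  · exact (lorentzNorm_top_le_iff hn p x _).2 (h.rearr_le x)
  have hu' : u ≠ ⊤ := ne_top_of_le_ne_top hv huv
  set q := (1 / p).toReal
  set M := lorentzNorm n p u x with hMdef
  have hM : 0 ≤ M := h.nonneg x
  have hMU : lorentzSum n q u.toReal x = M ^ u.toReal := by
    rw [hMdef, lorentzNorm_of_ne_top n hu', one_div u.toReal,
      Real.rpow_inv_rpow (lorentzSum_nonneg _ _ _ _) (ENNReal.toReal_pos hu.ne' hu').ne']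
  have hU : 0 < u.toReal := ENNReal.toReal_pos hu.ne' hu'
  have hUV : u.toReal ≤ v.toReal := ENNReal.toReal_mono hv huv
  rw [lorentzNorm_of_ne_top n hv]
  set U := u.toReal
  set V := v.toReal
  have hV : 0 < V := hU.trans_le hUV
  have hsum : lorentzSum n q V x ≤ (K * M) ^ V := by
    calc lorentzSum n q V x
        ≤ ∑ i ∈ Finset.Icc 1 n, (i : ℝ) ^ (U * q - 1) * rearr n x i ^ U * (K * M) ^ (V - U) := by
          refine Finset.sum_le_sum fun i hi => ?_
          have hi0 : (0 : ℝ) < i := by exact_mod_cast (Finset.mem_Icc.1 hi).1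
          have hr := rearr_nonneg n x i
          have hsplit : (i : ℝ) ^ (V * q - 1) * rearr n x i ^ V =
              (i : ℝ) ^ (U * q - 1) * rearr n x i ^ U * ((i : ℝ) ^ q * rearr n x i) ^ (V - U) := by
            rw [Real.mul_rpow (by positivity) hr, ← Real.rpow_mul hi0.le,
              show V * q - 1 = (U * q - 1) + q * (V - U) by ring, Real.rpow_add hi0]
            have hrV : rearr n x i ^ V = rearr n x i ^ U * rearr n x i ^ (V - U) := by
              rw [← Real.rpow_add_of_nonneg hr hU.le (sub_nonneg.2 hUV), add_sub_cancel]
            rw [hrV]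
            ring
          rw [hsplit]
          have := h.rearr_le x i hi
          have := sub_nonneg.2 hUV
          gcongr
      _ = M ^ U * (K * M) ^ (V - U) := by rw [← Finset.sum_mul, ← hMU]; rfl
      _ ≤ (K * M) ^ U * (K * M) ^ (V - U) := by
          gcongr
          exact le_mul_of_one_le_left hM hK
      _ = (K * M) ^ V := by
          rw [← Real.rpow_add_of_nonneg (by positivity) hU.le (sub_nonneg.2 hUV)]
          congr 1; ring
  refine (Real.rpow_le_rpow (lorentzSum_nonneg _ _ _ _) hsum (by positivity)).trans_eq ?_
  rw [one_div, Real.rpow_rpow_inv (by positivity) hV.ne']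

namespace LorentzBounds

variable {n : ℕ} {N : (Fin n → ℝ) → ℝ} {K q : ℝ}

theorem le_one_of_norm_le (h : LorentzBounds n N K q) (hn : 0 < n) (hK : 1 ≤ K) (x : Fin n → ℝ)
    (hx : ‖x‖ ≤ (K * (n : ℝ) ^ q)⁻¹) : N x ≤ 1 := by
  have hpos : 0 < K * (n : ℝ) ^ q := by positivity
  calc N x ≤ K * (n : ℝ) ^ q * ‖x‖ := h.le_norm x
    _ ≤ K * (n : ℝ) ^ q * (K * (n : ℝ) ^ q)⁻¹ := by gcongr
    _ = 1 := mul_inv_cancel₀ hpos.ne'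

theorem volume_ne_zero (h : LorentzBounds n N K q) (hn : 0 < n) (hK : 1 ≤ K) :
    volume {x | N x ≤ 1} ≠ 0 := by
  have hpos : 0 < (K * (n : ℝ) ^ q)⁻¹ := by positivity
  refine (lt_of_lt_of_le (Metric.measure_closedBall_pos volume 0 hpos) (measure_mono ?_)).ne'
  exact fun x hx => h.le_one_of_norm_le hn hK x (mem_closedBall_zero_iff.1 hx)

open scoped Pointwise in
theorem volume_le (h : LorentzBounds n N K q) (hn : 0 < n) (hK : 1 ≤ K) (hq : 0 ≤ q) :
    volume {x | N x ≤ 1} ≤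
      ENNReal.ofReal ((K * ((n : ℝ) ^ q)⁻¹ * (2 * Real.pi * Real.exp (2 * q))) ^ n) := by
  set c := K * ((n : ℝ) ^ q)⁻¹ with hc
  have hc0 : 0 < c := by positivity
  have hsub : {x | N x ≤ 1} ⊆ c • {x : Fin n → ℝ | ∀ i ∈ Finset.Icc 1 n,
      (i : ℝ) ^ q * rearr n x i ≤ (n : ℝ) ^ q} := by
    intro x hx
    rw [Set.mem_smul_set_iff_inv_smul_mem₀ hc0.ne']
    intro i hi
    rw [rearr_smul x i (inv_pos.2 hc0), mul_left_comm, inv_mul_le_iff₀ hc0, hc, mul_assoc,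
      inv_mul_cancel₀ (by positivity)]
    refine (h.rearr_le x i hi).trans ?_
    gcongr
    exact hx
  refine (measure_mono hsub).trans ?_
  rw [Measure.addHaar_smul, Module.finrank_fin_fun, abs_of_pos (by positivity), mul_pow c,
    ENNReal.ofReal_mul (by positivity)]
  exact mul_le_mul_right (volume_rearr_le n hn hq) _

end LorentzBounds

/-- Case (III.1) of the main theorem: for `0 < p = q < ∞` and `0 < u ≤ v ≤ ∞`,
`e_k(id : ℓ_{p,u}^n → ℓ_{p,v}^n) ≍ 2^{-k/n}` uniformly in `k` and `n`. -/
theorem entropy_lorentz_pu_pv_of_le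
    (p u v : ℝ≥0∞) (hp : 0 < p) (hp' : p ≠ ⊤) (hu : 0 < u) (huv : u ≤ v) :
    ∃ c C : ℝ, 0 < c ∧ 0 < C ∧ ∀ n k : ℕ, 0 < n → 0 < k →
      c * (2 : ℝ) ^ (-(k : ℝ) / (n : ℝ)) ≤
          entropyNumber n (lorentzNorm n p u) (lorentzNorm n p v) k ∧
        entropyNumber n (lorentzNorm n p u) (lorentzNorm n p v) k ≤
          C * (2 : ℝ) ^ (-(k : ℝ) / (n : ℝ)) := by

  have hq : 0 < (1 / p).toReal := ENNReal.toReal_pos (by simpa using hp') (by simpa using hp.ne')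
  obtain ⟨K, hK, hX⟩ := exists_lorentzBounds (p := p) hq hu
  obtain ⟨L, hL, hY⟩ := exists_lorentzBounds (p := p) hq (hu.trans_le huv)
  set q := (1 / p).toReal
  set B : ℝ := 2 * Real.pi * Real.exp (2 * q) with hB
  have hB0 : 0 < B := by positivity
  refine ⟨2 / (K * L * B), K * (4 * K ^ 2) * 2, by positivity, by positivity,
    fun n k hn hk => ?_⟩
  have hn0 : (0 : ℝ) < n := by exact_mod_cast hn
  have hn1 : (1 : ℝ) ≤ n := by exact_mod_cast hn
  obtain ⟨T, hT, hcov⟩ := exists_cover hn hk hK (hX n hn).smul (hX n hn).neg (hX n hn).add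
    (hX n hn).closed ((hX n hn).volume_ne_zero hn hK)
    (ne_top_of_le_ne_top ENNReal.ofReal_ne_top ((hX n hn).volume_le hn hK hq.le))
  set r : ℝ := (2 : ℝ) ^ (-((k : ℝ) - 1) / n) with hr
  have hr0 : 0 < r := by positivity
  have hmem : K * (4 * K ^ 2 * r) ∈ {ε : ℝ | 0 < ε ∧ ∃ T : Finset (Fin n → ℝ),
      T.card ≤ 2 ^ (k - 1) ∧ ∀ x : Fin n → ℝ, lorentzNorm n p u x ≤ 1 →
        ∃ y ∈ T, lorentzNorm n p v (x - y) ≤ ε} := by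
    refine ⟨by positivity, T, hT, fun x hx => ?_⟩
    obtain ⟨y, hy, hxy⟩ := hcov x hx
    exact ⟨y, hy, (lorentzNorm_le_of_le hu huv hK hn (hX n hn) _).trans (by gcongr)⟩
  constructor
  · refine le_csInf ⟨_, hmem⟩ ?_
    rintro ε ⟨hε, S, hS, hScov⟩
    have h := le_of_cover hn hk (by positivity) (by positivity) hε
      ((hX n hn).le_one_of_norm_le hn hK) (hY n hn).smul ((hY n hn).volume_le hn hL hq.le) hS hScov
    refine le_trans ?_ h
    rw [← hB]
    have hconst : 2 * (K * (n : ℝ) ^ q)⁻¹ / (L * ((n : ℝ) ^ q)⁻¹ * B) = 2 / (K * L * B) := by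
      field_simp
    rw [hconst]
    gcongr
    · norm_num
    · linarith
  · refine (csInf_le ⟨0, fun ε hε => hε.1.le⟩ hmem).trans ?_
    have hr2 : r ≤ 2 * (2 : ℝ) ^ (-(k : ℝ) / n) := by
      have h1 : r = (2 : ℝ) ^ (1 / (n : ℝ)) * (2 : ℝ) ^ (-(k : ℝ) / n) := by
        rw [hr, ← Real.rpow_add two_pos]; congr 1; ring
      rw [h1]
      gcongr
      refine (Real.rpow_le_rpow_of_exponent_le one_le_two ?_).trans_eq (Real.rpow_one 2)
      rwa [div_le_one hn0]
    calc K * (4 * K ^ 2 * r) ≤ K * (4 * K ^ 2 * (2 * (2 : ℝ) ^ (-(k : ℝ) / n))) := by gcongr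
      _ = _ := by ring
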